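/- Let w(x1,x2) be a weight on R^{n⃗} = R^{n1} × R^{n2}. A locally integrable function b on R^{n⃗} belongs to the weighted little bmo(w) if and only if b belongs to the one-parameter weighted BMO spaces separately in each variable, uniformly; in fact ‖b‖_{bmo(w)} is comparable (with absolute constants) to max{ esssup_{x1∈R^{n1}} ‖b(x1,·)‖_{BMO(w(x1,·))}, esssup_{x2∈R^{n2}} ‖b(·,x2)‖_{BMO(w(·,x2))} }, where ‖b(x1,·)‖_{BMO(w(x1,·))} := sup_{Q2} (1/w(Q2,x1)) ∫_{Q2} |b(x1,x2) − m_{Q2}b(x1)| dx2 and symmetrically in the other variable. -/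

import Mathlib

open MeasureTheory Set Filter
open scoped ENNReal NNReal BigOperators Topology Classical

noncomputable section


/-- Model of `ℝ^n`. -/
abbrev Rn (n : ℕ) := Fin n → ℝ

/-- Euclidean norm on `Rn n`. -/
def eunorm {n : ℕ} (x : Rn n) : ℝ := Real.sqrt (∑ i, x i ^ 2)

/-- The axis-parallel cube with corner `c` and side length `l`. -/
def cubeSet {n : ℕ} (c : Rn n) (l : ℝ) : Set (Rn n) :=
  Set.univ.pi fun i => Set.Ico (c i) (c i + l)

/-- A cube in `ℝ^n` with sides parallel to the axes. -/
def IsCube {n : ℕ} (Q : Set (Rn n)) : Prop := ∃ c l, 0 < l ∧ Q = cubeSet c l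

/-- A rectangle `R = Q1 × Q2` in `ℝ^{n1} × ℝ^{n2}`. -/
def IsRect {n1 n2 : ℕ} (R : Set (Rn n1 × Rn n2)) : Prop :=
  ∃ Q1 Q2, IsCube Q1 ∧ IsCube Q2 ∧ R = Q1 ×ˢ Q2

/-- A weight: an a.e. positive, locally integrable (measurable) function. -/
def IsWeight {α : Type*} [MeasureSpace α] [TopologicalSpace α] (w : α → ℝ) : Prop :=
  Measurable w ∧ (∀ᵐ x ∂(volume : Measure α), 0 < w x) ∧ LocallyIntegrable w volume

/-- One-parameter Muckenhoupt `A_p` condition, with constant `A`: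
`⟨v⟩_Q ⟨v^{1-p'}⟩_Q^{p-1} ≤ A` for all cubes `Q` (note `1 - p' = -1/(p-1)`). -/
def ApOne {n : ℕ} (p : ℝ) (v : Rn n → ℝ) (A : ℝ) : Prop :=
  ∀ Q : Set (Rn n), IsCube Q →
    (⨍ x in Q, v x) * (⨍ x in Q, v x ^ (-1 / (p - 1))) ^ (p - 1) ≤ A

/-- Biparameter Muckenhoupt `A_p` condition, with constant `A`: the same bound over all
rectangles `R = Q1 × Q2`. -/
def ApBi {n1 n2 : ℕ} (p : ℝ) (w : Rn n1 × Rn n2 → ℝ) (A : ℝ) : Prop :=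
  ∀ R : Set (Rn n1 × Rn n2), IsRect R →
    (⨍ x in R, w x) * (⨍ x in R, w x ^ (-1 / (p - 1))) ^ (p - 1) ≤ A

/-- The norm of `f` in `L^p(w)`, i.e. `(∫ |f|^p w dx)^{1/p}`, valued in `ℝ≥0∞`. -/
def lpNormW {α : Type*} [MeasureSpace α] (p : ℝ) (w : α → ℝ) (f : α → ℝ) : ℝ≥0∞ :=
  (∫⁻ x, ENNReal.ofReal (|f x| ^ p * w x)) ^ (1 / p)

/-- `‖b‖_{bmo(w)} ≤ B` : weighted little bmo over all rectangles. -/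
def bmoRectLe {n1 n2 : ℕ} (w b : Rn n1 × Rn n2 → ℝ) (B : ℝ) : Prop :=
  ∀ R : Set (Rn n1 × Rn n2), IsRect R →
    (∫ x in R, |b x - ⨍ y in R, b y|) ≤ B * ∫ x in R, w x

/-- `‖g‖_{BMO(ℝ^n)} ≤ B` : one-parameter unweighted BMO. -/
def bmoOneLe {n : ℕ} (g : Rn n → ℝ) (B : ℝ) : Prop :=
  ∀ Q : Set (Rn n), IsCube Q → (∫ x in Q, |g x - ⨍ y in Q, g y|) ≤ B * (volume Q).toReal

/-- `‖g‖_{BMO(v)} ≤ B` : one-parameter weighted BMO. -/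
def bmoOneWLe {n : ℕ} (v g : Rn n → ℝ) (B : ℝ) : Prop :=
  ∀ Q : Set (Rn n), IsCube Q → (∫ x in Q, |g x - ⨍ y in Q, g y|) ≤ B * ∫ x in Q, v x

/-- The commutator `[b, S] f = b · Sf - S(b f)`. -/
def commut {α : Type*} (b : α → ℝ) (S : (α → ℝ) → (α → ℝ)) (f : α → ℝ) : α → ℝ :=
  fun x => b x * S f x - S (fun y => b y * f y) x


/-- A "nice" function: bounded, measurable, compactly supported. -/
def NiceFun {n : ℕ} (f : Rn n → ℝ) : Prop :=
  Measurable f ∧ (∃ M, ∀ x, |f x| ≤ M) ∧ HasCompactSupport f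

theorem integral_abs_sub_average_le_two_mul {α : Type*} [MeasurableSpace α] {ν : Measure α}
    [IsFiniteMeasure ν] {g : α → ℝ} (hg : Integrable g ν) (c : ℝ) :
    ∫ x, |g x - ⨍ y, g y ∂ν| ∂ν ≤ 2 * ∫ x, |g x - c| ∂ν := by
  set a := ⨍ y, g y ∂ν with ha
  have hc : Integrable (fun x => g x - c) ν := hg.sub (integrable_const c)
  have hmass : ν.real univ * |c - a| ≤ ∫ x, |g x - c| ∂ν := by
    have hmul : ν.real univ * (a - c) = ∫ x, (g x - c) ∂ν := by
      rw [integral_sub hg (integrable_const c), integral_const, mul_sub, smul_eq_mul, ha,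
        ← smul_eq_mul (ν.real univ), measure_smul_average]
    calc ν.real univ * |c - a| = |ν.real univ * (a - c)| := by
          rw [abs_mul, abs_of_nonneg measureReal_nonneg, abs_sub_comm]
      _ ≤ ∫ x, |g x - c| ∂ν := by rw [hmul]; exact abs_integral_le_integral_abs
  calc ∫ x, |g x - a| ∂ν ≤ ∫ x, (|g x - c| + |c - a|) ∂ν :=
        integral_mono (hg.sub (integrable_const a)).abs (hc.abs.add (integrable_const _))
          fun x => abs_sub_le _ _ _
    _ = (∫ x, |g x - c| ∂ν) + ν.real univ * |c - a| := by
        rw [integral_add hc.abs (integrable_const _), integral_const, smul_eq_mul]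
    _ ≤ 2 * ∫ x, |g x - c| ∂ν := by linarith

section Prod

variable {α β : Type*} [MeasurableSpace α] [MeasurableSpace β] {μ : Measure α} {ν : Measure β}
  [IsFiniteMeasure ν] {b : α × β → ℝ}

theorem integrable_slice_average (hb : Integrable b (μ.prod ν)) :
    Integrable (fun x => ⨍ y, b (x, y) ∂ν) μ := by
  simp only [average_eq, smul_eq_mul]
  exact hb.integral_prod_left.const_mul _

theorem integrable_sub_slice_average (hb : Integrable b (μ.prod ν)) :
    Integrable (fun z : α × β => b z - ⨍ y, b (z.1, y) ∂ν) (μ.prod ν) :=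
  hb.sub ((integrable_slice_average hb).comp_fst ν)

variable [IsFiniteMeasure μ]

theorem integral_slice_oscillation_le (hb : Integrable b (μ.prod ν)) (c : ℝ) :
    ∫ x, ∫ y, |b (x, y) - ⨍ y', b (x, y') ∂ν| ∂ν ∂μ ≤ 2 * ∫ z, |b z - c| ∂μ.prod ν := by
  have hc : Integrable (fun z => |b z - c|) (μ.prod ν) := (hb.sub (integrable_const c)).abs
  rw [integral_prod _ hc, ← integral_const_mul]
  refine integral_mono_ae (integrable_sub_slice_average hb).abs.integral_prod_left
    (hc.integral_prod_left.const_mul 2) ?_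
  filter_upwards [hb.prod_right_ae] with x hx
  exact integral_abs_sub_average_le_two_mul hx c

theorem integral_abs_sub_slice_average_le {w : α × β → ℝ} {B : ℝ} (hb : Integrable b (μ.prod ν))
    (hw : Integrable w (μ.prod ν))
    (h : ∀ᵐ x ∂μ, ∫ y, |b (x, y) - ⨍ y', b (x, y') ∂ν| ∂ν ≤ B * ∫ y, w (x, y) ∂ν) :
    ∫ z, |b z - ⨍ y, b (z.1, y) ∂ν| ∂μ.prod ν ≤ B * ∫ z, w z ∂μ.prod ν := by
  have hi := (integrable_sub_slice_average hb).abs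
  rw [integral_prod _ hi, integral_prod _ hw, ← integral_const_mul]
  exact integral_mono_ae hi.integral_prod_left (hw.integral_prod_left.const_mul B) h

theorem integral_abs_sub_average_prod_le (hb : Integrable b (μ.prod ν)) :
    ∫ z, |b z - ⨍ z', b z' ∂μ.prod ν| ∂μ.prod ν ≤
      (∫ z, |b z - ⨍ y, b (z.1, y) ∂ν| ∂μ.prod ν) +
        ∫ z, |b z - ⨍ x, b (x, z.2) ∂μ| ∂μ.prod ν := by
  set c := ⨍ z', b z' ∂μ.prod ν with hc
  have hm := integrable_slice_average hb
  have hm' : Integrable (fun y => ⨍ x, b (x, y) ∂μ) ν := integrable_slice_average hb.swap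
  have hi := (integrable_sub_slice_average hb).abs
  have hi' : Integrable (fun z : α × β => |b z - ⨍ x, b (x, z.2) ∂μ|) (μ.prod ν) :=
    (hb.sub (hm'.comp_snd μ)).abs
  have hmc : Integrable (fun x => |(⨍ y, b (x, y) ∂ν) - c|) μ := (hm.sub (integrable_const c)).abs
  have hmean : ν.real univ * c = ∫ y, ⨍ x, b (x, y) ∂μ ∂ν := by
    simp only [average_eq, hc, smul_eq_mul, integral_const_mul]
    rw [integral_prod_symm _ hb, measureReal_def (μ.prod ν), ← univ_prod_univ, Measure.prod_prod,
      ENNReal.toReal_mul, ← measureReal_def, ← measureReal_def]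
    rcases eq_or_ne (ν.real univ) 0 with h0 | h0
    · have : ν = 0 := by simpa [measureReal_def, ENNReal.toReal_eq_zero_iff] using h0
      simp [this]
    · field_simp
  have key : ∫ z : α × β, |(⨍ y, b (z.1, y) ∂ν) - c| ∂μ.prod ν ≤
      ∫ z, |b z - ⨍ x, b (x, z.2) ∂μ| ∂μ.prod ν := by
    rw [integral_prod _ (hmc.comp_fst ν), integral_prod _ hi']
    refine integral_mono_ae (hmc.comp_fst ν).integral_prod_left hi'.integral_prod_left ?_
    filter_upwards [hb.prod_right_ae] with x hx
    have hmul : ν.real univ * ((⨍ y, b (x, y) ∂ν) - c) =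
        ∫ y, (b (x, y) - ⨍ x', b (x', y) ∂μ) ∂ν := by
      rw [integral_sub hx hm', mul_sub, hmean, ← smul_eq_mul (ν.real univ), measure_smul_average]
    simp only [integral_const, smul_eq_mul]
    rw [← abs_of_nonneg (measureReal_nonneg (μ := ν) (s := univ)), ← abs_mul, hmul]
    exact abs_integral_le_integral_abs
  calc ∫ z, |b z - c| ∂μ.prod ν
      ≤ ∫ z, (|b z - ⨍ y, b (z.1, y) ∂ν| + |(⨍ y, b (z.1, y) ∂ν) - c|) ∂μ.prod ν :=
        integral_mono (hb.sub (integrable_const c)).abs (hi.add (hmc.comp_fst ν))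
          fun z => abs_sub_le _ _ _
    _ ≤ _ := by
        rw [integral_add hi (hmc.comp_fst ν)]
        gcongr

end Prod

section Cubes

variable {n : ℕ}

theorem cubeSet_subset_Icc (c : Rn n) (l : ℝ) : cubeSet c l ⊆ Icc c fun i => c i + l := fun _ hx =>
  ⟨fun i => (hx i trivial).1, fun i => (hx i trivial).2.le⟩

theorem cubeSet_ae_eq_Icc (c : Rn n) (l : ℝ) : cubeSet c l =ᵐ[volume] Icc c fun i => c i + l :=
  Measure.univ_pi_Ico_ae_eq_Icc

theorem measurableSet_cubeSet (c : Rn n) (l : ℝ) : MeasurableSet (cubeSet c l) :=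
  MeasurableSet.univ_pi fun _ => measurableSet_Ico

theorem volume_real_cubeSet_pos (c : Rn n) {l : ℝ} (hl : 0 < l) : 0 < volume.real (cubeSet c l) := by
  rw [measureReal_def, cubeSet, Real.volume_pi_Ico_toReal fun i => by simpa using hl.le]
  simpa using pow_pos hl n

theorem IsCube.exists_isCompact {Q : Set (Rn n)} (hQ : IsCube Q) : ∃ K, IsCompact K ∧ Q ⊆ K := by
  obtain ⟨c, l, -, rfl⟩ := hQ
  exact ⟨_, isCompact_Icc, cubeSet_subset_Icc c l⟩

theorem IsCube.finite_restrict {Q : Set (Rn n)} (hQ : IsCube Q) :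
    IsFiniteMeasure (volume.restrict Q) := by
  obtain ⟨K, hK, hQK⟩ := hQ.exists_isCompact
  exact isFiniteMeasure_restrict.2 ((measure_mono hQK).trans_lt hK.measure_lt_top).ne

/-- In the sup norm, closed balls are cubes up to null sets. -/
theorem cubeSet_ae_eq_closedBall (x : Rn n) {r : ℝ} (hr : 0 ≤ r) :
    cubeSet (fun i => x i - r) (2 * r) =ᵐ[volume] Metric.closedBall x r := by
  have hball : Metric.closedBall x r = Icc (fun i => x i - r) fun i => x i - r + 2 * r := by
    rw [closedBall_pi x hr, ← pi_univ_Icc]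
    congr! 2 with i
    rw [Real.closedBall_eq_Icc]
    ring_nf
  rw [hball]
  exact cubeSet_ae_eq_Icc _ _

theorem ae_le_of_setIntegral_cube_le {f g : Rn n → ℝ} (hf : LocallyIntegrable f volume)
    (hg : LocallyIntegrable g volume)
    (h : ∀ Q, IsCube Q → ∫ x in Q, f x ≤ ∫ x in Q, g x) : ∀ᵐ x, f x ≤ g x := by
  filter_upwards [IsUnifLocDoublingMeasure.ae_tendsto_average volume hf 1,
    IsUnifLocDoublingMeasure.ae_tendsto_average volume hg 1] with x hfx hgx
  have hmem : ∀ᶠ r : ℝ in 𝓝[>] 0, x ∈ Metric.closedBall x (1 * r) := by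
    filter_upwards [self_mem_nhdsWithin] with r hr
    simpa using (mem_Ioi.1 hr).le
  refine le_of_tendsto_of_tendsto (hfx (fun _ => x) id tendsto_id hmem)
    (hgx (fun _ => x) id tendsto_id hmem) ?_
  filter_upwards [self_mem_nhdsWithin] with r hr
  have hr : 0 < r := hr
  have hcube := cubeSet_ae_eq_closedBall x hr.le
  simp only [id, setAverage_eq, ← setIntegral_congr_set hcube, smul_eq_mul]
  exact mul_le_mul_of_nonneg_left (h _ ⟨_, _, by positivity, rfl⟩)
    (inv_nonneg.2 measureReal_nonneg)

theorem tendsto_indicator_cubeSet {c : ℕ → Rn n} {l : ℕ → ℝ} {c₀ : Rn n} {l₀ : ℝ}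
    (hc : Tendsto c atTop (𝓝 c₀)) (hl : Tendsto l atTop (𝓝 l₀)) :
    ∀ᵐ x, ∀ᶠ k in atTop, (x ∈ cubeSet (c k) (l k) ↔ x ∈ cubeSet c₀ l₀) := by
  have hne (a : Rn n) : ∀ᵐ x : Rn n, ∀ i, x i ≠ a i :=
    ae_all_iff.2 fun i => Measure.ae_eval_ne (fun _ : Fin n => (volume : Measure ℝ)) i (a i)
  filter_upwards [hne c₀, hne fun i => c₀ i + l₀] with x hx hx'
  have hci (i) : Tendsto (fun k => c k i) atTop (𝓝 (c₀ i)) := tendsto_pi_nhds.1 hc i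
  have hcoord (i : Fin n) : ∀ᶠ k in atTop,
      (x i ∈ Ico (c k i) (c k i + l k) ↔ x i ∈ Ico (c₀ i) (c₀ i + l₀)) := by
    have h1 : ∀ᶠ k in atTop, (c k i ≤ x i ↔ c₀ i ≤ x i) := by
      rcases (hx i).lt_or_gt with h | h
      · filter_upwards [(hci i).eventually_const_lt h] with k hk
        exact iff_of_false hk.not_ge h.not_ge
      · filter_upwards [(hci i).eventually_lt_const h] with k hk
        exact iff_of_true hk.le h.le
    have h2 : ∀ᶠ k in atTop, (x i < c k i + l k ↔ x i < c₀ i + l₀) := by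
      rcases (hx' i).lt_or_gt with h | h
      · filter_upwards [((hci i).add hl).eventually_const_lt h] with k hk
        exact iff_of_true hk h
      · filter_upwards [((hci i).add hl).eventually_lt_const h] with k hk
        exact iff_of_false hk.not_gt h.not_gt
    filter_upwards [h1, h2] with k h1 h2
    rw [mem_Ico, mem_Ico, h1, h2]
  filter_upwards [eventually_all.2 hcoord] with k hk
  simp only [cubeSet, mem_univ_pi, hk]

theorem locallyIntegrable_abs {u : Rn n → ℝ} (hu : LocallyIntegrable u volume) :
    LocallyIntegrable (fun x => |u x|) volume := fun x => by
  obtain ⟨s, hs, hus⟩ := hu x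
  exact ⟨s, hs, hus.abs⟩

theorem tendsto_setIntegral_cubeSet {c : ℕ → Rn n} {l : ℕ → ℝ} {c₀ : Rn n} {l₀ : ℝ}
    (hc : Tendsto c atTop (𝓝 c₀)) (hl : Tendsto l atTop (𝓝 l₀)) {F : ℕ → Rn n → ℝ}
    {f G : Rn n → ℝ} (hF : ∀ k, AEStronglyMeasurable (F k) volume)
    (hG : LocallyIntegrable G volume) (hFG : ∀ᶠ k in atTop, ∀ x, |F k x| ≤ G x)
    (hlim : ∀ x, Tendsto (fun k => F k x) atTop (𝓝 (f x))) :
    Tendsto (fun k => ∫ x in cubeSet (c k) (l k), F k x) atTop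
      (𝓝 (∫ x in cubeSet c₀ l₀, f x)) := by
  simp only [← integral_indicator (measurableSet_cubeSet _ _)]
  set K : Set (Rn n) := Icc (fun i => c₀ i - 1) (fun i => c₀ i + 1 + (l₀ + 1)) with hK
  have hci (i) : Tendsto (fun k => c k i) atTop (𝓝 (c₀ i)) := tendsto_pi_nhds.1 hc i
  have hsub : ∀ᶠ k in atTop, cubeSet (c k) (l k) ⊆ K := by
    have h1 : ∀ᶠ k in atTop, ∀ i, c₀ i - 1 < c k i :=
      eventually_all.2 fun i => (hci i).eventually_const_lt (by linarith)
    have h2 : ∀ᶠ k in atTop, ∀ i, c k i < c₀ i + 1 :=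
      eventually_all.2 fun i => (hci i).eventually_lt_const (by linarith)
    filter_upwards [h1, h2, hl.eventually_lt_const (lt_add_one l₀)] with k h1 h2 h3
    exact (cubeSet_subset_Icc _ _).trans
      (Icc_subset_Icc (fun i => (h1 i).le) fun i => (add_lt_add (h2 i) h3).le)
  refine tendsto_integral_filter_of_dominated_convergence (K.indicator G)
    (Eventually.of_forall fun k => (hF k).indicator (measurableSet_cubeSet _ _)) ?_
    ((hG.integrableOn_isCompact isCompact_Icc).integrable_indicator measurableSet_Icc) ?_
  · filter_upwards [hsub, hFG] with k hk hFGk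
    refine Eventually.of_forall fun x => ?_
    rw [norm_indicator_eq_indicator_norm]
    refine (indicator_le_indicator (hFGk x)).trans
      (indicator_le_indicator_of_subset hk (fun y => (abs_nonneg _).trans (hFGk y)) x)
  · filter_upwards [tendsto_indicator_cubeSet hc hl] with x hx
    by_cases hx₀ : x ∈ cubeSet c₀ l₀
    · rw [indicator_of_mem hx₀]
      refine (hlim x).congr' ?_
      filter_upwards [hx] with k hk
      rw [indicator_of_mem (hk.2 hx₀)]
    · rw [indicator_of_notMem hx₀]
      refine tendsto_const_nhds.congr' ?_
      filter_upwards [hx] with k hk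
      rw [indicator_of_notMem (mt hk.1 hx₀)]

theorem bmoOneWLe_of_dense {g v : Rn n → ℝ} {C : ℝ} (hg : LocallyIntegrable g volume)
    (hv : LocallyIntegrable v volume) {S : Set (Rn n × ℝ)} (hS : Dense S)
    (h : ∀ p ∈ S, 0 < p.2 → ∫ x in cubeSet p.1 p.2, |g x - ⨍ y in cubeSet p.1 p.2, g y| ≤
      C * ∫ x in cubeSet p.1 p.2, v x) : bmoOneWLe v g C := by
  rintro Q ⟨c₀, l₀, hl₀, rfl⟩
  obtain ⟨p, hpS, hp⟩ := mem_closure_iff_seq_limit.1 (hS (c₀, l₀))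
  have hc : Tendsto (fun k => (p k).1) atTop (𝓝 c₀) := (continuous_fst.tendsto _).comp hp
  have hl : Tendsto (fun k => (p k).2) atTop (𝓝 l₀) := (continuous_snd.tendsto _).comp hp
  have hint {u : Rn n → ℝ} (hu : LocallyIntegrable u volume) :
      Tendsto (fun k => ∫ x in cubeSet (p k).1 (p k).2, u x) atTop
        (𝓝 (∫ x in cubeSet c₀ l₀, u x)) :=
    tendsto_setIntegral_cubeSet hc hl (fun _ => hu.aestronglyMeasurable) (locallyIntegrable_abs hu)
      (Eventually.of_forall fun _ _ => le_rfl) fun _ => tendsto_const_nhds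
  have havg : Tendsto (fun k => ⨍ y in cubeSet (p k).1 (p k).2, g y) atTop
      (𝓝 (⨍ y in cubeSet c₀ l₀, g y)) := by
    have hvol := hint (locallyIntegrable_const (1 : ℝ))
    simp only [setIntegral_const, smul_eq_mul, mul_one] at hvol
    simp only [setAverage_eq]
    exact (hvol.inv₀ (volume_real_cubeSet_pos c₀ hl₀).ne').smul (hint hg)
  have hosc : Tendsto (fun k => ∫ x in cubeSet (p k).1 (p k).2,
      |g x - ⨍ y in cubeSet (p k).1 (p k).2, g y|) atTop
      (𝓝 (∫ x in cubeSet c₀ l₀, |g x - ⨍ y in cubeSet c₀ l₀, g y|)) := by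
    refine tendsto_setIntegral_cubeSet hc hl
      (fun k => (hg.aestronglyMeasurable.sub aestronglyMeasurable_const).norm)
      ((locallyIntegrable_abs hg).add (locallyIntegrable_const (|⨍ y in cubeSet c₀ l₀, g y| + 1))) ?_
      fun x => (tendsto_const_nhds.sub havg).abs
    filter_upwards [havg.abs.eventually_lt_const (lt_add_one _)] with k hk x
    rw [abs_abs]
    exact (abs_sub _ _).trans (add_le_add le_rfl hk.le)
  refine le_of_tendsto_of_tendsto hosc ((hint hv).const_mul C) ?_
  filter_upwards [hl.eventually_const_lt hl₀] with k hk using h _ (hpS k) hk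

end Cubes

section Slices

variable {n1 n2 : ℕ} {w b : Rn n1 × Rn n2 → ℝ}

theorem MeasureTheory.LocallyIntegrable.integrable_prod_restrict {u : Rn n1 × Rn n2 → ℝ}
    (hu : LocallyIntegrable u volume) {K₁ : Set (Rn n1)} {K₂ : Set (Rn n2)} (h₁ : IsCompact K₁)
    (h₂ : IsCompact K₂) {A₁ : Set (Rn n1)} {A₂ : Set (Rn n2)} (hA₁ : A₁ ⊆ K₁) (hA₂ : A₂ ⊆ K₂) :
    Integrable u ((volume.restrict A₁).prod (volume.restrict A₂)) := by
  rw [Measure.prod_restrict, ← Measure.volume_eq_prod]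
  exact (hu.integrableOn_isCompact (h₁.prod h₂)).mono_set (prod_mono hA₁ hA₂)

theorem MeasureTheory.LocallyIntegrable.ae_slice {u : Rn n1 × Rn n2 → ℝ}
    (hu : LocallyIntegrable u volume) :
    ∀ᵐ x1, LocallyIntegrable (fun x2 => u (x1, x2)) volume := by
  have h (N : ℕ) : ∀ᵐ x1 : Rn n1, IntegrableOn (fun x2 => u (x1, x2)) (Metric.closedBall 0 N) := by
    rw [← Measure.restrict_univ (μ := (volume : Measure (Rn n1))),
      ← Metric.iUnion_closedBall_nat (0 : Rn n1), ae_restrict_iUnion_iff]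
    intro M
    exact (hu.integrable_prod_restrict (isCompact_closedBall 0 (M : ℝ))
      (isCompact_closedBall 0 (N : ℝ)) subset_rfl subset_rfl).prod_right_ae
  filter_upwards [ae_all_iff.2 h] with x1 hx
  refine locallyIntegrable_iff.2 fun K hK => ?_
  obtain ⟨r, hr⟩ := hK.isBounded.subset_closedBall 0
  obtain ⟨N, hN⟩ := exists_nat_ge r
  exact (hx N).mono_set (hr.trans (Metric.closedBall_subset_closedBall hN))

theorem MeasureTheory.LocallyIntegrable.comp_prodSwap {u : Rn n1 × Rn n2 → ℝ}
    (hu : LocallyIntegrable u volume) : LocallyIntegrable (u ∘ Prod.swap) volume := by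
  refine locallyIntegrable_iff.2 fun K hK => ?_
  have h₁ := hK.image continuous_fst
  have h₂ := hK.image continuous_snd
  have := (hu.integrable_prod_restrict h₂ h₁ subset_rfl subset_rfl).swap
  rw [Measure.prod_restrict, ← Measure.volume_eq_prod] at this
  exact this.mono_measure (Measure.restrict_mono_set _ fun z hz =>
    ⟨mem_image_of_mem _ hz, mem_image_of_mem _ hz⟩)

theorem bmoRectLe.comp_swap {B : ℝ} (h : bmoRectLe w b B) :
    bmoRectLe (w ∘ Prod.swap) (b ∘ Prod.swap) B := by
  rintro R ⟨Q2, Q1, h2, h1, rfl⟩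
  have hR := h _ ⟨Q1, Q2, h1, h2, rfl⟩
  have havg : ⨍ z in Q2 ×ˢ Q1, (b ∘ Prod.swap) z = ⨍ z in Q1 ×ˢ Q2, b z := by
    rw [setAverage_eq, setAverage_eq, Measure.volume_eq_prod, Measure.volume_eq_prod,
      measureReal_prod_prod, measureReal_prod_prod, mul_comm]
    exact congrArg _ (setIntegral_prod_swap Q1 Q2 b)
  rw [havg]
  refine (setIntegral_prod_swap Q1 Q2 fun z => |b z - ⨍ y in Q1 ×ˢ Q2, b y|).trans_le
    (hR.trans_eq (congrArg _ (setIntegral_prod_swap Q1 Q2 w).symm))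

theorem bmoRectLe.ae_slice (hw : LocallyIntegrable w volume) (hb : LocallyIntegrable b volume)
    {B : ℝ} (h : bmoRectLe w b B) :
    ∀ᵐ x1 : Rn n1, bmoOneWLe (fun x2 => w (x1, x2)) (fun x2 => b (x1, x2)) (2 * B) := by
  have hcube (Q2 : Set (Rn n2)) (hQ2 : IsCube Q2) : ∀ᵐ x1 : Rn n1,
      ∫ x2 in Q2, |b (x1, x2) - ⨍ y in Q2, b (x1, y)| ≤ 2 * B * ∫ x2 in Q2, w (x1, x2) := by
    have := hQ2.finite_restrict
    obtain ⟨K2, hK2, hQK2⟩ := hQ2.exists_isCompact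
    refine ae_le_of_setIntegral_cube_le ?_ ?_ fun Q1 hQ1 => ?_
    · refine locallyIntegrable_iff.2 fun K hK => ?_
      have : IsFiniteMeasure (volume.restrict K) := isFiniteMeasure_restrict.2 hK.measure_lt_top.ne
      exact (integrable_sub_slice_average
        (hb.integrable_prod_restrict hK hK2 subset_rfl hQK2)).abs.integral_prod_left
    · refine locallyIntegrable_iff.2 fun K hK => ?_
      exact (hw.integrable_prod_restrict hK hK2 subset_rfl hQK2).integral_prod_left.const_mul _
    · have := hQ1.finite_restrict
      obtain ⟨K1, hK1, hQK1⟩ := hQ1.exists_isCompact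
      have hR := h _ ⟨Q1, Q2, hQ1, hQ2, rfl⟩
      rw [Measure.volume_eq_prod, ← Measure.prod_restrict] at hR
      rw [integral_const_mul,
        ← integral_prod _ (hw.integrable_prod_restrict hK1 hK2 hQK1 hQK2)]
      have := integral_slice_oscillation_le (hb.integrable_prod_restrict hK1 hK2 hQK1 hQK2)
        (⨍ y, b y ∂(volume.restrict Q1).prod (volume.restrict Q2))
      linarith
  obtain ⟨S, hSc, hSd⟩ := TopologicalSpace.exists_countable_dense (Rn n2 × ℝ)
  have hall : ∀ᵐ x1 : Rn n1, ∀ p ∈ S, 0 < p.2 →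
      ∫ x2 in cubeSet p.1 p.2, |b (x1, x2) - ⨍ y in cubeSet p.1 p.2, b (x1, y)| ≤
        2 * B * ∫ x2 in cubeSet p.1 p.2, w (x1, x2) :=
    (ae_ball_iff hSc).2 fun p _ => eventually_imp_distrib_left.2 fun hp =>
      hcube _ ⟨p.1, p.2, hp, rfl⟩
  filter_upwards [hw.ae_slice, hb.ae_slice, hall] with x1 hwx hbx hx
  exact bmoOneWLe_of_dense hbx hwx hSd hx

theorem setIntegral_abs_sub_slice_average_le (hw : LocallyIntegrable w volume)
    (hb : LocallyIntegrable b volume) {B : ℝ}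
    (h : ∀ᵐ x1 : Rn n1, bmoOneWLe (fun x2 => w (x1, x2)) (fun x2 => b (x1, x2)) B)
    {Q1 : Set (Rn n1)} {Q2 : Set (Rn n2)} (hQ1 : IsCube Q1) (hQ2 : IsCube Q2) :
    ∫ z in Q1 ×ˢ Q2, |b z - ⨍ y in Q2, b (z.1, y)| ≤ B * ∫ z in Q1 ×ˢ Q2, w z := by
  have := hQ1.finite_restrict
  have := hQ2.finite_restrict
  obtain ⟨K1, hK1, hQK1⟩ := hQ1.exists_isCompact
  obtain ⟨K2, hK2, hQK2⟩ := hQ2.exists_isCompact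
  rw [Measure.volume_eq_prod, ← Measure.prod_restrict]
  refine integral_abs_sub_slice_average_le (hb.integrable_prod_restrict hK1 hK2 hQK1 hQK2)
    (hw.integrable_prod_restrict hK1 hK2 hQK1 hQK2) (ae_restrict_of_ae ?_)
  filter_upwards [h] with x1 hx using hx Q2 hQ2

theorem bmoRectLe_of_ae_slices (hw : LocallyIntegrable w volume) (hw0 : ∀ᵐ z, 0 < w z)
    (hb : LocallyIntegrable b volume) {B1 B2 : ℝ}
    (h1 : ∀ᵐ x1 : Rn n1, bmoOneWLe (fun x2 => w (x1, x2)) (fun x2 => b (x1, x2)) B1)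
    (h2 : ∀ᵐ x2 : Rn n2, bmoOneWLe (fun x1 => w (x1, x2)) (fun x1 => b (x1, x2)) B2) :
    bmoRectLe w b (2 * max B1 B2) := by
  rintro R ⟨Q1, Q2, hQ1, hQ2, rfl⟩
  have := hQ1.finite_restrict
  have := hQ2.finite_restrict
  obtain ⟨K1, hK1, hQK1⟩ := hQ1.exists_isCompact
  obtain ⟨K2, hK2, hQK2⟩ := hQ2.exists_isCompact
  have hs1 := setIntegral_abs_sub_slice_average_le hw hb h1 hQ1 hQ2
  have hs2 := setIntegral_abs_sub_slice_average_le hw.comp_prodSwap hb.comp_prodSwap h2 hQ2 hQ1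
  have hsplit := integral_abs_sub_average_prod_le (hb.integrable_prod_restrict hK1 hK2 hQK1 hQK2)
  have hw_nonneg : 0 ≤ ∫ z in Q1 ×ˢ Q2, w z :=
    integral_nonneg_of_ae (ae_restrict_of_ae (hw0.mono fun _ h => h.le))
  have hm1 := mul_le_mul_of_nonneg_right (le_max_left B1 B2) hw_nonneg
  have hm2 := mul_le_mul_of_nonneg_right (le_max_right B1 B2) hw_nonneg
  have hsw1 : ∫ z in Q2 ×ˢ Q1, (w ∘ Prod.swap) z = ∫ z in Q1 ×ˢ Q2, w z :=
    setIntegral_prod_swap Q1 Q2 w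
  have hsw2 : ∫ z in Q2 ×ˢ Q1, |(b ∘ Prod.swap) z - ⨍ x in Q1, (b ∘ Prod.swap) (z.1, x)| =
      ∫ z in Q1 ×ˢ Q2, |b z - ⨍ x in Q1, b (x, z.2)| :=
    setIntegral_prod_swap Q1 Q2 fun z => |b z - ⨍ x in Q1, b (x, z.2)|
  rw [Measure.prod_restrict, ← Measure.volume_eq_prod] at hsplit
  rw [hsw1, hsw2] at hs2
  refine (hsplit.trans (add_le_add hs1 hs2)).trans ?_
  linarith

end Slices

/-- **Proposition.** For any weight `w` on `ℝ^{n⃗}`, a locally integrable `b` is in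
`bmo(w)` iff it is uniformly in the one-parameter weighted BMO spaces separately in
each variable; the norms are comparable with absolute constants. -/
theorem little_bmo_iff_uniform_one_parameter_BMO :
    ∃ c1 c2 : ℝ, 0 < c1 ∧ 0 < c2 ∧
      ∀ (n1 n2 : ℕ) (w b : Rn n1 × Rn n2 → ℝ), IsWeight w → Measurable b →
        LocallyIntegrable b volume →
        (∀ B : ℝ, 0 ≤ B → bmoRectLe w b B →
          (∀ᵐ x1 : Rn n1 ∂volume,
            bmoOneWLe (fun x2 => w (x1, x2)) (fun x2 => b (x1, x2)) (c1 * B)) ∧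
          (∀ᵐ x2 : Rn n2 ∂volume,
            bmoOneWLe (fun x1 => w (x1, x2)) (fun x1 => b (x1, x2)) (c1 * B))) ∧
        (∀ B1 B2 : ℝ, 0 ≤ B1 → 0 ≤ B2 →
          (∀ᵐ x1 : Rn n1 ∂volume,
            bmoOneWLe (fun x2 => w (x1, x2)) (fun x2 => b (x1, x2)) B1) →
          (∀ᵐ x2 : Rn n2 ∂volume,
            bmoOneWLe (fun x1 => w (x1, x2)) (fun x1 => b (x1, x2)) B2) →
          bmoRectLe w b (c2 * max B1 B2)) := by
  refine ⟨2, 2, two_pos, two_pos, fun n1 n2 w b hw _ hb => ⟨fun B _ h => ?_, ?_⟩⟩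
  · exact ⟨h.ae_slice hw.2.2 hb, h.comp_swap.ae_slice hw.2.2.comp_prodSwap hb.comp_prodSwap⟩
  · exact fun B1 B2 _ _ => bmoRectLe_of_ae_slices hw.2.2 hw.2.1 hb
end
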